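/- arXiv:1710.04525 — 5 statements merged into one kernel-verified Lean document; each statement's English description precedes it below -/
import Mathlib

section
/- Fix mass fractions φ_l, φ_g, φ_v > 0 with φ_l + φ_g + φ_v = 1, and let s_l, s_g, s_v : (0,∞)² → ℝ be strictly concave functions. Define, for (τ, e) ∈ (0,∞)², s(τ,e) = sup { φ_l s_l(τ_l,e_l) + φ_g s_g(τ_g,e_g) + φ_v s_v(τ_v,e_v) : τ_k, e_k > 0, e = φ_l e_l + φ_g e_g + φ_v e_v, τ = φ_l τ_l + φ_g τ_g, φ_v τ_v = φ_g τ_g }. If for every (τ,e) ∈ (0,∞)² this supremum is finite and attained, then s is strictly concave on (0,∞)². -/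
open Set

/-- The open positive quadrant `(0,∞)²` of states `(τ, e)`. -/
def posQuadrant : Set (ℝ × ℝ) := {p | 0 < p.1 ∧ 0 < p.2}

/-- with fixed positive mass fractions `φ_l + φ_g + φ_v = 1` and strictly
concave phasic entropies `s_l, s_g, s_v` on `(0,∞)²`, if for every `(τ,e) ∈ (0,∞)²` the
intensive equilibrium mixture entropy
`s(τ,e) = sup { φ_l s_l(τ_l,e_l) + φ_g s_g(τ_g,e_g) + φ_v s_v(τ_v,e_v) }`
(over positive `τ_k, e_k` with `e = φ_l e_l + φ_g e_g + φ_v e_v`,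
`τ = φ_l τ_l + φ_g τ_g` and `φ_v τ_v = φ_g τ_g`) is finite and attained, then `s` is
strictly concave on `(0,∞)²`. -/
theorem mixture_entropy_strictConcave
    (φl φg φv : ℝ) (hφl : 0 < φl) (hφg : 0 < φg) (hφv : 0 < φv)
    (hsum : φl + φg + φv = 1)
    (sl sg sv : ℝ × ℝ → ℝ)
    (hsl : StrictConcaveOn ℝ posQuadrant sl)
    (hsg : StrictConcaveOn ℝ posQuadrant sg)
    (hsv : StrictConcaveOn ℝ posQuadrant sv)
    (s : ℝ × ℝ → ℝ)
    (hs : ∀ p ∈ posQuadrant,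
      IsGreatest {r : ℝ | ∃ τl el τg eg τv ev : ℝ,
        0 < τl ∧ 0 < el ∧ 0 < τg ∧ 0 < eg ∧ 0 < τv ∧ 0 < ev ∧
        p.2 = φl * el + φg * eg + φv * ev ∧
        p.1 = φl * τl + φg * τg ∧
        φv * τv = φg * τg ∧
        r = φl * sl (τl, el) + φg * sg (τg, eg) + φv * sv (τv, ev)} (s p)) :
    StrictConcaveOn ℝ posQuadrant s := by
  refine ⟨hsl.1, fun p hp q hq hpq a b ha hb hab => ?_⟩
  obtain ⟨τl, el, τg, eg, τv, ev, hτl, hel, hτg, heg, hτv, hev, he, hτ, hgv, hr⟩ := (hs p hp).1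
  obtain ⟨τl', el', τg', eg', τv', ev', hτl', hel', hτg', heg', hτv', hev', he', hτ', hgv', hr'⟩ :=
    (hs q hq).1
  have hl := hsl.concaveOn.2 (show (τl, el) ∈ posQuadrant from ⟨hτl, hel⟩)
    (show (τl', el') ∈ posQuadrant from ⟨hτl', hel'⟩) ha.le hb.le hab
  have hg := hsg.concaveOn.2 (show (τg, eg) ∈ posQuadrant from ⟨hτg, heg⟩)
    (show (τg', eg') ∈ posQuadrant from ⟨hτg', heg'⟩) ha.le hb.le hab
  have hv := hsv.concaveOn.2 (show (τv, ev) ∈ posQuadrant from ⟨hτv, hev⟩)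
    (show (τv', ev') ∈ posQuadrant from ⟨hτv', hev'⟩) ha.le hb.le hab
  have hle := (hs _ (hsl.1 hp hq ha.le hb.le hab)).2
    ⟨a * τl + b * τl', a * el + b * el', a * τg + b * τg', a * eg + b * eg',
      a * τv + b * τv', a * ev + b * ev', by positivity, by positivity, by positivity,
      by positivity, by positivity, by positivity,
      by simp only [Prod.snd_add, Prod.smul_snd, smul_eq_mul, he, he']; ring,
      by simp only [Prod.fst_add, Prod.smul_fst, smul_eq_mul, hτ, hτ']; ring,
      by linear_combination a * hgv + b * hgv', rfl⟩
  refine lt_of_lt_of_le ?_ hle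
  simp only [Prod.smul_mk, Prod.mk_add_mk, smul_eq_mul] at hl hg hv ⊢
  rw [hr, hr']
  have hl₁ := mul_le_mul_of_nonneg_left hl hφl.le
  have hg₁ := mul_le_mul_of_nonneg_left hg hφg.le
  have hv₁ := mul_le_mul_of_nonneg_left hv hφv.le
  -- Distinct mixture states differ in at least one phase, where the inequality is strict.
  by_cases hle' : (τl, el) = (τl', el')
  · by_cases hge' : (τg, eg) = (τg', eg')
    · have hve' : (τv, ev) ≠ (τv', ev') := by
        intro h
        simp only [Prod.mk.injEq] at hle' hge' h
        apply hpq
        ext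
        · rw [hτ, hτ', hle'.1, hge'.1]
        · rw [he, he', hle'.2, hge'.2, h.2]
      have hlt := mul_lt_mul_of_pos_left
        (hsv.2 (show (τv, ev) ∈ posQuadrant from ⟨hτv, hev⟩)
          (show (τv', ev') ∈ posQuadrant from ⟨hτv', hev'⟩) hve' ha hb hab) hφv
      simp only [Prod.smul_mk, Prod.mk_add_mk, smul_eq_mul] at hlt
      linarith
    · have hlt := mul_lt_mul_of_pos_left
        (hsg.2 (show (τg, eg) ∈ posQuadrant from ⟨hτg, heg⟩)
          (show (τg', eg') ∈ posQuadrant from ⟨hτg', heg'⟩) hge' ha hb hab) hφg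
      simp only [Prod.smul_mk, Prod.mk_add_mk, smul_eq_mul] at hlt
      linarith
  · have hlt := mul_lt_mul_of_pos_left
      (hsl.2 (show (τl, el) ∈ posQuadrant from ⟨hτl, hel⟩)
        (show (τl', el') ∈ posQuadrant from ⟨hτl', hel'⟩) hle' ha hb hab) hφl
    simp only [Prod.smul_mk, Prod.mk_add_mk, smul_eq_mul] at hlt
    linarith
end

section
/- Let Ω ⊆ ℝ² be open and let ρ, u, E, φ_l, φ_g : Ω → ℝ be C¹ functions of (t,x) with ρ > 0 on Ω. Set τ = 1/ρ and e = E − u²/2, and let p : Ω → ℝ be continuous. Assume the conservation laws hold on Ω: ∂_t ρ + ∂_x(ρu) = 0, ∂_t(ρu) + ∂_x(ρu² + p) = 0, ∂_t(ρE) + ∂_x((ρE + p)u) = 0, and ∂_t(φ_k ρ) + ∂_x(φ_k ρ u) = 0 for k = l, g. Let σ : U ⊆ ℝ⁴ → ℝ be C¹ on an open set U containing the range of (τ, e, φ_l, φ_g), and assume the Gibbs compatibility ∂σ/∂τ(τ,e,φ_l,φ_g) = p · ∂σ/∂e(τ,e,φ_l,φ_g) holds pointwise on Ω. Then the function s(t,x)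 := σ(τ(t,x), e(t,x), φ_l(t,x), φ_g(t,x)) satisfies the transport equation ∂_t s + u ∂_x s = 0 on Ω. -/
noncomputable section

/-- Partial derivative with respect to time `t` of a function of `(t,x)`. -/
def partialT (f : ℝ × ℝ → ℝ) (z : ℝ × ℝ) : ℝ := fderiv ℝ f z (1, 0)

/-- Partial derivative with respect to space `x` of a function of `(t,x)`. -/
def partialX (f : ℝ × ℝ → ℝ) (z : ℝ × ℝ) : ℝ := fderiv ℝ f z (0, 1)

/-- A continuous linear functional on `ℝ⁴` is determined by its values on the standard basis. -/
theorem clm_apply_eq_sum_basis (L : ℝ × ℝ × ℝ × ℝ →L[ℝ] ℝ) (a b c d : ℝ) :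
    L (a, b, c, d) = a * L (1, 0, 0, 0) + b * L (0, 1, 0, 0) + c * L (0, 0, 1, 0)
      + d * L (0, 0, 0, 1) := by
  have h : ((a, b, c, d) : ℝ × ℝ × ℝ × ℝ) = a • (1, 0, 0, 0) + b • (0, 1, 0, 0)
      + c • (0, 0, 1, 0) + d • (0, 0, 0, 1) := by simp
  rw [h]
  simp only [map_add, map_smul, smul_eq_mul]

/-- A scalar carried by a conserved density `φ ρ`, where `ρ` is itself conserved, is advected. -/
theorem advection_of_conservation {ρ u φ : ℝ × ℝ → ℝ} {z : ℝ × ℝ}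
    (hρ : DifferentiableAt ℝ ρ z) (hu : DifferentiableAt ℝ u z) (hφ : DifferentiableAt ℝ φ z)
    (hρz : ρ z ≠ 0)
    (hmass : partialT ρ z + partialX (fun w => ρ w * u w) z = 0)
    (hfrac : partialT (fun w => φ w * ρ w) z + partialX (fun w => φ w * ρ w * u w) z = 0) :
    partialT φ z + u z * partialX φ z = 0 := by
  simp only [partialT, partialX] at *
  rw [(hρ.hasFDerivAt.fun_mul hu.hasFDerivAt).fderiv] at hmass
  rw [(hφ.hasFDerivAt.fun_mul hρ.hasFDerivAt).fderiv,
    ((hφ.hasFDerivAt.fun_mul hρ.hasFDerivAt).fun_mul hu.hasFDerivAt).fderiv] at hfrac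
  simp only [add_apply, smul_apply, smul_eq_mul]
    at hmass hfrac
  apply mul_left_cancel₀ hρz
  linear_combination hfrac - φ z * hmass

/-- entropy transport for smooth solutions of the equilibrium
multicomponent Euler system without phase transition. If the conservation laws hold on
an open set `Ω`, and if the mixture entropy `σ(τ, e, φ_l, φ_g)` (C¹ on an open set
containing the range of `(τ, e, φ_l, φ_g) = (1/ρ, E − u²/2, φ_l, φ_g)`) satisfies the
Gibbs compatibility `∂_τ σ = p ∂_e σ` along the solution, then
`s = σ(τ, e, φ_l, φ_g)` satisfies the transport equation `∂_t s + u ∂_x s = 0` on `Ω`. -/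
theorem entropy_transport
    (Ω : Set (ℝ × ℝ)) (hΩ : IsOpen Ω)
    (ρ u E φl φg p : ℝ × ℝ → ℝ)
    (hρ : ContDiffOn ℝ 1 ρ Ω) (hu : ContDiffOn ℝ 1 u Ω) (hE : ContDiffOn ℝ 1 E Ω)
    (hφl : ContDiffOn ℝ 1 φl Ω) (hφg : ContDiffOn ℝ 1 φg Ω)
    (hρpos : ∀ z ∈ Ω, 0 < ρ z)
    (hp : ContinuousOn p Ω)
    -- the fluxes containing the pressure are differentiable, as implicitly required for
    -- the conservation laws to hold in the strong (pointwise) sense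
    (hmomflux : DifferentiableOn ℝ (fun w => ρ w * u w ^ 2 + p w) Ω)
    (henflux : DifferentiableOn ℝ (fun w => (ρ w * E w + p w) * u w) Ω)
    -- conservation laws
    (hmass : ∀ z ∈ Ω, partialT ρ z + partialX (fun w => ρ w * u w) z = 0)
    (hmom : ∀ z ∈ Ω,
      partialT (fun w => ρ w * u w) z + partialX (fun w => ρ w * u w ^ 2 + p w) z = 0)
    (hen : ∀ z ∈ Ω,
      partialT (fun w => ρ w * E w) z
        + partialX (fun w => (ρ w * E w + p w) * u w) z = 0)
    (hfracl : ∀ z ∈ Ω,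
      partialT (fun w => φl w * ρ w) z + partialX (fun w => φl w * ρ w * u w) z = 0)
    (hfracg : ∀ z ∈ Ω,
      partialT (fun w => φg w * ρ w) z + partialX (fun w => φg w * ρ w * u w) z = 0)
    -- the mixture entropy
    (U : Set (ℝ × ℝ × ℝ × ℝ)) (hU : IsOpen U)
    (σ : ℝ × ℝ × ℝ × ℝ → ℝ) (hσ : ContDiffOn ℝ 1 σ U)
    (hrange : ∀ z ∈ Ω, ((ρ z)⁻¹, E z - u z ^ 2 / 2, φl z, φg z) ∈ U)
    -- Gibbs compatibility ∂σ/∂τ = p · ∂σ/∂e along the solution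
    (hGibbs : ∀ z ∈ Ω,
      fderiv ℝ σ ((ρ z)⁻¹, E z - u z ^ 2 / 2, φl z, φg z) (1, 0, 0, 0) =
        p z * fderiv ℝ σ ((ρ z)⁻¹, E z - u z ^ 2 / 2, φl z, φg z) (0, 1, 0, 0)) :
    ∀ z ∈ Ω,
      partialT (fun w => σ ((ρ w)⁻¹, E w - u w ^ 2 / 2, φl w, φg w)) z
        + u z * partialX (fun w => σ ((ρ w)⁻¹, E w - u w ^ 2 / 2, φl w, φg w)) z
        = 0 := by
  intro z hz
  have hmem := hΩ.mem_nhds hz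
  have dρ := (hρ.differentiableOn one_ne_zero).differentiableAt hmem
  have du := (hu.differentiableOn one_ne_zero).differentiableAt hmem
  have dE := (hE.differentiableOn one_ne_zero).differentiableAt hmem
  have dl := (hφl.differentiableOn one_ne_zero).differentiableAt hmem
  have dg := (hφg.differentiableOn one_ne_zero).differentiableAt hmem
  have dσ := (hσ.differentiableOn one_ne_zero).differentiableAt (hU.mem_nhds (hrange z hz))
  have dp : DifferentiableAt ℝ p z := by
    have h := (hmomflux.differentiableAt hmem).fun_sub (dρ.fun_mul (du.fun_pow 2))
    simpa using h
  have hρz : ρ z ≠ 0 := (hρpos z hz).ne'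
  have hl := advection_of_conservation dρ du dl hρz (hmass z hz) (hfracl z hz)
  have hg := advection_of_conservation dρ du dg hρz (hmass z hz) (hfracg z hz)
  have hm := hmass z hz
  have hmo := hmom z hz
  have he := hen z hz
  have hG := hGibbs z hz
  have hτ := (hasDerivAt_inv hρz).comp_hasFDerivAt z dρ.hasFDerivAt
  have hsq : HasFDerivAt (fun w => u w ^ 2) ((2 * u z) • fderiv ℝ u z) z := by
    refine ((hasDerivAt_pow 2 (u z)).comp_hasFDerivAt z du.hasFDerivAt).congr_fderiv ?_
    simp
  have hint : HasFDerivAt (fun w => E w - u w ^ 2 / 2) (fderiv ℝ E z - u z • fderiv ℝ u z) z := by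
    simp only [div_eq_mul_inv]
    refine (dE.hasFDerivAt.fun_sub (hsq.mul_const 2⁻¹)).congr_fderiv ?_
    simp [smul_smul]
  have hs := dσ.hasFDerivAt.comp z
    (hτ.prodMk (hint.prodMk (dl.hasFDerivAt.prodMk dg.hasFDerivAt)))
  have hs' := hs.fderiv
  simp only [Function.comp_def] at hs'
  simp only [partialT, partialX] at *
  rw [hs']
  rw [(dρ.hasFDerivAt.fun_mul du.hasFDerivAt).fderiv] at hm hmo
  rw [((dρ.hasFDerivAt.fun_mul hsq).fun_add dp.hasFDerivAt).fderiv] at hmo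
  rw [(dρ.hasFDerivAt.fun_mul dE.hasFDerivAt).fderiv,
    (((dρ.hasFDerivAt.fun_mul dE.hasFDerivAt).fun_add dp.hasFDerivAt).fun_mul
      du.hasFDerivAt).fderiv] at he
  simp only [ContinuousLinearMap.comp_apply, ContinuousLinearMap.prod_apply]
  rw [clm_apply_eq_sum_basis, clm_apply_eq_sum_basis _ _ _ (fderiv ℝ φl z (0, 1)), hG]
  generalize fderiv ℝ σ _ (0, 1, 0, 0) = σe
  generalize fderiv ℝ σ _ (0, 0, 1, 0) = σl
  generalize fderiv ℝ σ _ (0, 0, 0, 1) = σg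
  simp only [add_apply, sub_apply,
    smul_apply, smul_eq_mul] at hm hmo he ⊢
  field_simp
  linear_combination ρ z ^ 2 * (σl * hl + σg * hg) + σe * ρ z * (he - u z * hmo)
    - σe * p z * hm + σe * ρ z * (u z ^ 2 - E z) * hm
end
end

section
/- Let u, p, a, b, d ∈ ℝ and ρ ∈ ℝ with ρ ≠ 0, and consider the 4×4 real matrix M = [[u, 0, 0, 0], [0, u, ρ, 0], [a, b, u, d], [0, 0, p/ρ, u]]. Then the characteristic polynomial of M is (X − u)² · ((X − u)² − c²), where c² := ρb + d·p/ρ. In particular, if c² ≥ 0, the eigenvalues of M are u − c, u, u, u + c with c = √(c²). -/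
open Polynomial

/-- the characteristic polynomial of the Jacobian matrix
`M = [[u,0,0,0],[0,u,ρ,0],[a,b,u,d],[0,0,p/ρ,u]]` of the three-phase equilibrium Euler
system with phase transition is `(X − u)² ((X − u)² − c²)` with `c² = ρb + d·p/ρ`;
in particular if `c² ≥ 0` the eigenvalues are `u − c, u, u, u + c` with `c = √(c²)`. -/
theorem charpoly_three_phase_jacobian (u p a b d ρ : ℝ) (hρ : ρ ≠ 0) :
    Matrix.charpoly !![u, 0, 0, 0; 0, u, ρ, 0; a, b, u, d; 0, 0, p / ρ, u] =
      (X - C u) ^ 2 * ((X - C u) ^ 2 - C (ρ * b + d * p / ρ)) ∧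
    (0 ≤ ρ * b + d * p / ρ →
      Matrix.charpoly !![u, 0, 0, 0; 0, u, ρ, 0; a, b, u, d; 0, 0, p / ρ, u] =
        (X - C (u - Real.sqrt (ρ * b + d * p / ρ))) * (X - C u) ^ 2 *
          (X - C (u + Real.sqrt (ρ * b + d * p / ρ)))) := by
  have charpoly_eq : Matrix.charpoly !![u, 0, 0, 0; 0, u, ρ, 0; a, b, u, d; 0, 0, p / ρ, u] =
      (X - C u) ^ 2 * ((X - C u) ^ 2 - C (ρ * b + d * p / ρ)) := by
    rw [mul_div_assoc]
    simp [Matrix.charpoly, Matrix.charmatrix, Matrix.det_succ_row_zero, Fin.sum_univ_succ,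
      Fin.succAbove, -map_div₀]
    ring
  refine ⟨charpoly_eq, fun hc => ?_⟩
  have sq_sqrt_C : C (ρ * b + d * p / ρ) = C (Real.sqrt (ρ * b + d * p / ρ)) ^ 2 := by
    rw [← C_pow, Real.sq_sqrt hc]
  rw [charpoly_eq, sq_sqrt_C, C_sub, C_add]
  ring
end

section
/- Let Ω ⊆ ℝ² be open and convex and σ : Ω → ℝ a C² concave function of (τ, e) with ∂σ/∂e > 0 on Ω. Define T := 1/(∂σ/∂e) and p := T · ∂σ/∂τ on Ω. Then p·∂p/∂e − ∂p/∂τ ≥ 0 on Ω. -/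
noncomputable section

/-- Partial derivative with respect to the specific volume `τ` (first variable). -/
def dTau (f : ℝ × ℝ → ℝ) (z : ℝ × ℝ) : ℝ := fderiv ℝ f z (1, 0)

/-- Partial derivative with respect to the specific internal energy `e` (second
variable). -/
def dE (f : ℝ × ℝ → ℝ) (z : ℝ × ℝ) : ℝ := fderiv ℝ f z (0, 1)

/-- The second derivative of a concave function along a direction is nonpositive. -/
theorem ConcaveOn.fderiv_fderiv_apply_self_nonpos {E : Type*} [NormedAddCommGroup E]
    [NormedSpace ℝ E] {s : Set E} {f : E → ℝ} (hs : IsOpen s) (hf : ConcaveOn ℝ s f)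
    (hd : DifferentiableOn ℝ f s) {x : E} (hx : x ∈ s)
    (hd' : DifferentiableAt ℝ (fderiv ℝ f) x) (v : E) :
    fderiv ℝ (fderiv ℝ f) x v v ≤ 0 := by
  let L : ℝ →ᵃ[ℝ] E := AffineMap.lineMap x (x + v)
  have hL : ∀ t, L t = x + t • v := fun t => by
    simp [L, AffineMap.lineMap_apply, add_comm]
  have hLd : ∀ t, HasDerivAt (fun t => L t) v t := fun t => by
    simp only [hL]
    simpa using ((hasDerivAt_id t).smul_const v).const_add x
  have hL0 : L 0 = x := by simp [L]
  have hU : IsOpen (L ⁻¹' s) :=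
    hs.preimage (continuous_iff_continuousAt.2 fun t => (hLd t).continuousAt)
  have h0 : (0 : ℝ) ∈ L ⁻¹' s := by simpa [hL0] using hx
  have hg : ∀ t ∈ L ⁻¹' s, HasDerivAt (f ∘ L) (fderiv ℝ f (L t) v) t := fun t ht =>
    ((hd.differentiableAt (hs.mem_nhds ht)).hasFDerivAt).comp_hasDerivAt t (hLd t)
  have hanti : AntitoneOn (fun t => fderiv ℝ f (L t) v) (L ⁻¹' s) :=
    ((hf.comp_affineMap L).antitoneOn_deriv
      fun t ht => (hg t ht).differentiableAt).congr fun t ht => (hg t ht).deriv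
  have hder : HasDerivAt (fun t => fderiv ℝ f (L t) v) (fderiv ℝ (fderiv ℝ f) x v v) 0 := by
    have hB : HasFDerivAt (fderiv ℝ f) (fderiv ℝ (fderiv ℝ f) x) (L 0) := by
      rw [hL0]; exact hd'.hasFDerivAt
    simpa using (hB.comp_hasDerivAt (0 : ℝ) (hLd 0)).clm_apply (hasDerivAt_const (0 : ℝ) v)
  have h := hanti.derivWithin_nonpos (x := 0)
  rwa [derivWithin_of_isOpen hU h0, hder.deriv] at h

/-- for a C² *concave* specific entropy `σ(τ,e)` on an open convex set,
with `∂σ/∂e > 0`, `T = 1/(∂σ/∂e)` and `p = T ∂σ/∂τ`, the quantity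
`p ∂p/∂e − ∂p/∂τ` (which equals `c²/τ²`, `c` the sound speed) is nonnegative. -/
theorem sound_speed_nonneg
    (Ω : Set (ℝ × ℝ)) (hΩopen : IsOpen Ω) (hΩconv : Convex ℝ Ω)
    (σ : ℝ × ℝ → ℝ) (hσ : ContDiffOn ℝ 2 σ Ω)
    (hconc : ConcaveOn ℝ Ω σ)
    (hσe : ∀ z ∈ Ω, 0 < dE σ z) :
    ∀ z ∈ Ω,
      0 ≤ (fun w => (dE σ w)⁻¹ * dTau σ w) z
            * dE (fun w => (dE σ w)⁻¹ * dTau σ w) z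
          - dTau (fun w => (dE σ w)⁻¹ * dTau σ w) z := by
  intro z hz
  have hnhds := hΩopen.mem_nhds hz
  have hd' : DifferentiableAt ℝ (fderiv ℝ σ) z :=
    ((hσ.contDiffAt hnhds).fderiv_right (m := 1) (by norm_num)).differentiableAt (by norm_num)
  have hpartial : ∀ u : ℝ × ℝ, HasFDerivAt (fun w => fderiv ℝ σ w u)
      ((fderiv ℝ (fderiv ℝ σ) z).flip u) z := fun u => by
    simpa using hd'.hasFDerivAt.clm_apply (hasFDerivAt_const u z)
  have hpos := hσe z hz
  have hp := ((hasDerivAt_inv hpos.ne').comp_hasFDerivAt z (hpartial (0, 1))).mul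
    (hpartial (1, 0))
  have hfd : fderiv ℝ (fun w => (dE σ w)⁻¹ * dTau σ w) z = _ := hp.fderiv
  set p := (dE σ z)⁻¹ * dTau σ z with hpdef
  have hconc2 := hconc.fderiv_fderiv_apply_self_nonpos hΩopen
    (hσ.differentiableOn (by norm_num)) hz hd' (-1, p)
  have hv : ((-1, p) : ℝ × ℝ) = p • (0, 1) - (1, 0) := by simp
  rw [hv] at hconc2
  have key : p * dE (fun w => (dE σ w)⁻¹ * dTau σ w) z
      - dTau (fun w => (dE σ w)⁻¹ * dTau σ w) z
      = (dE σ z)⁻¹ * -(fderiv ℝ (fderiv ℝ σ) z (p • (0, 1) - (1, 0)) (p • (0, 1) - (1, 0))) := by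
    rw [dE, dTau, hfd, hpdef]
    simp only [map_sub, map_smul, sub_apply, smul_apply,
      add_apply, ContinuousLinearMap.flip_apply, smul_eq_mul,
      Function.comp_apply]
    simp only [dE, dTau] at hpos ⊢
    field_simp
    ring
  change 0 ≤ p * _ - _
  rw [key]
  exact mul_nonneg (inv_nonneg.2 hpos.le) (neg_nonneg.2 hconc2)
end
end

section
/- Let D ⊆ (0,∞) × ℝ be convex and s : D → ℝ be strictly concave and strictly increasing in its second argument. Then the function η defined by η(τ, u, E) := −s(τ, E − u²/2) is strictly convex on the convex set {(τ, u, E) ∈ (0,∞) × ℝ × ℝ : (τ, E − u²/2) ∈ D}. -/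
/-- if `s(τ,e)` is strictly concave on a convex set `D ⊆ (0,∞) × ℝ` and
strictly increasing in `e`, then the Lagrangian mathematical entropy
`η(τ,u,E) = −s(τ, E − u²/2)` is strictly convex on the convex set
`{(τ,u,E) : τ > 0 and (τ, E − u²/2) ∈ D}`. -/
theorem lagrangian_entropy_strictConvex
    (D : Set (ℝ × ℝ)) (hD : Convex ℝ D)
    (hDpos : ∀ q ∈ D, 0 < q.1)
    (s : ℝ × ℝ → ℝ)
    (hs : StrictConcaveOn ℝ D s)
    (hmono : ∀ τ e e' : ℝ, (τ, e) ∈ D → (τ, e') ∈ D → e < e' → s (τ, e) < s (τ, e'))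
    (hK : Convex ℝ {w : ℝ × ℝ × ℝ | 0 < w.1 ∧ (w.1, w.2.2 - w.2.1 ^ 2 / 2) ∈ D}) :
    StrictConvexOn ℝ {w : ℝ × ℝ × ℝ | 0 < w.1 ∧ (w.1, w.2.2 - w.2.1 ^ 2 / 2) ∈ D}
      (fun w => -s (w.1, w.2.2 - w.2.1 ^ 2 / 2)) := by
  refine ⟨hK, ?_⟩
  rintro ⟨τ₁, u₁, E₁⟩ hx ⟨τ₂, u₂, E₂⟩ hy hxy a b ha hb hab
  have hm := (hK hx hy ha.le hb.le hab).2
  have hx' : (τ₁, E₁ - u₁ ^ 2 / 2) ∈ D := hx.2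
  have hy' : (τ₂, E₂ - u₂ ^ 2 / 2) ∈ D := hy.2
  have hq := hD hx' hy' ha.le hb.le hab
  simp only [Prod.smul_mk, Prod.mk_add_mk, smul_eq_mul] at hm hq ⊢
  have henergy : a * E₁ + b * E₂ - (a * u₁ + b * u₂) ^ 2 / 2
      = a * (E₁ - u₁ ^ 2 / 2) + b * (E₂ - u₂ ^ 2 / 2) + a * b * (u₁ - u₂) ^ 2 / 2 := by
    obtain rfl : b = 1 - a := by linarith
    ring
  by_cases hu : u₁ = u₂
  · subst hu
    have hne : (τ₁, E₁ - u₁ ^ 2 / 2) ≠ (τ₂, E₂ - u₁ ^ 2 / 2) := by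
      intro h
      apply hxy
      simp only [Prod.mk.injEq] at h ⊢
      exact ⟨h.1, trivial, by linarith [h.2]⟩
    have hlt := hs.2 hx' hy' hne ha hb hab
    simp only [Prod.smul_mk, Prod.mk_add_mk, smul_eq_mul] at hlt
    rw [henergy, sub_self, zero_pow two_ne_zero, mul_zero, zero_div, add_zero]
    linarith
  · have hpos : 0 < a * b * (u₁ - u₂) ^ 2 / 2 := by
      have := sub_ne_zero.mpr hu
      positivity
    have hlt := hmono _ _ _ hq hm (by linarith)
    have hle := hs.concaveOn.2 hx' hy' ha.le hb.le hab
    simp only [Prod.smul_mk, Prod.mk_add_mk, smul_eq_mul] at hle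
    linarith
end
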